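/- (PAC-Bayes-lambda bound.) Let 𝒵 be a measurable space, P a probability measure on 𝒵, 𝒲 a measurable space, and ℓ : 𝒲 × 𝒵 → ℝ a jointly measurable loss function taking values in [0,1]. Define the risk L(w) = ∫ ℓ(w,z) dP(z) and, for a sample z = (z₁,…,zₙ) ∈ 𝒵ⁿ, the empirical risk L̂ₙ(w, z) = (1/n)·Σᵢ₌₁ⁿ ℓ(w, zᵢ). Fix a probability measure Q⁰ on 𝒲 (the prior), an integer n ≥ 1, and δ ∈ (0,1). Then, with probability at least 1 − δ over samples z = (z₁,…,zₙ) drawn i.i.d. from P (i.e., with respect to the n-fold product measure Pⁿ), simultaneously for all probability measures Q on 𝒲 and all λ ∈ (0,2): ∫ L dQ ≤ ( ∫ L̂ₙ(·, z) dQ )/(1 − λ/2) + (KL(Q ‖ Q⁰) + log(2√n/δ))/(n·λ·(1 − λ/2)). -/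

import Mathlib

open MeasureTheory

/-- The Kullback-Leibler divergence `KL(Q ‖ Q') = ∫ log (dQ/dQ') dQ`, as a real
number.  This is the correct value whenever `Q ≪ Q'` and the log-density is
`Q`-integrable, i.e. whenever the KL divergence is finite. -/
noncomputable def klDiv {α : Type*} [MeasurableSpace α] (Q Q' : Measure α) : ℝ :=
  ∫ x, Real.log ((Q.rnDeriv Q') x).toReal ∂Q

lemma exp_neg_le_one_sub_add_sq_div_two {x : ℝ} (hx : 0 ≤ x) :
    Real.exp (-x) ≤ 1 - x + x ^ 2 / 2 := by
  rw [Real.exp_neg]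
  refine inv_le_of_inv_le₀ (by nlinarith [sq_nonneg (x - 1)]) ?_
  refine le_trans ?_ (Real.quadratic_le_exp_of_nonneg hx)
  rw [inv_le_iff_one_le_mul₀ (by nlinarith [sq_nonneg (x - 1)])]
  nlinarith [sq_nonneg (x ^ 2)]

/-- A Bernstein-type exponential moment bound for the lower deviations of a `[0,1]`-valued random
variable. -/
lemma integral_exp_lower_deviation_le_one {α : Type*} [MeasurableSpace α] (P : Measure α)
    [IsProbabilityMeasure P] {f : α → ℝ} (hf : Measurable f)
    (hf01 : ∀ x, f x ∈ Set.Icc (0 : ℝ) 1) {t : ℝ} (ht : 0 ≤ t) :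
    ∫ x, Real.exp (t * (∫ y, f y ∂P - f x) - t ^ 2 * (∫ y, f y ∂P) / 2) ∂P ≤ 1 := by
  set p := ∫ y, f y ∂P
  have hfi : Integrable f P :=
    Integrable.of_mem_Icc 0 1 hf.aemeasurable (ae_of_all _ hf01)
  have hexp : ∀ x, Real.exp (t * (p - f x) - t ^ 2 * p / 2)
      ≤ Real.exp (t * p - t ^ 2 * p / 2) * (1 - (t - t ^ 2 / 2) * f x) := by
    intro x
    obtain ⟨h0, h1⟩ := hf01 x
    rw [show t * (p - f x) - t ^ 2 * p / 2 = (t * p - t ^ 2 * p / 2) + -(t * f x) by ring,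
      Real.exp_add]
    gcongr
    refine (exp_neg_le_one_sub_add_sq_div_two (by positivity)).trans ?_
    nlinarith [mul_nonneg (sq_nonneg t) (mul_nonneg h0 (sub_nonneg.2 h1))]
  calc _ ≤ ∫ x, Real.exp (t * p - t ^ 2 * p / 2) * (1 - (t - t ^ 2 / 2) * f x) ∂P :=
        integral_mono_of_nonneg (ae_of_all _ fun x => (Real.exp_pos _).le)
          (((integrable_const _).sub (hfi.const_mul _)).const_mul _) (ae_of_all _ hexp)
    _ = Real.exp (t * p - t ^ 2 * p / 2) * (1 - (t - t ^ 2 / 2) * p) := by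
        rw [integral_const_mul, integral_sub (integrable_const _) (hfi.const_mul _),
          integral_const_mul]
        simp [p]
    _ ≤ Real.exp (t * p - t ^ 2 * p / 2) * Real.exp (-(t * p - t ^ 2 * p / 2)) := by
        gcongr
        linarith [Real.add_one_le_exp (-(t * p - t ^ 2 * p / 2))]
    _ = 1 := by rw [← Real.exp_add]; simp

lemma integral_exp_empirical_lower_deviation_le_one {α : Type*} [MeasurableSpace α]
    (P : Measure α) [IsProbabilityMeasure P] {f : α → ℝ} (hf : Measurable f)
    (hf01 : ∀ x, f x ∈ Set.Icc (0 : ℝ) 1) {n : ℕ} (hn : 1 ≤ n) {t : ℝ} (ht : 0 ≤ t) :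
    ∫ z, Real.exp (n * (t * (∫ y, f y ∂P - 1 / (n : ℝ) * ∑ i : Fin n, f (z i))
      - t ^ 2 * (∫ y, f y ∂P) / 2)) ∂(Measure.pi fun _ : Fin n => P) ≤ 1 := by
  set p := ∫ y, f y ∂P
  have hn0 : (n : ℝ) ≠ 0 := by positivity
  have hprod : ∀ z : Fin n → α,
      Real.exp (n * (t * (p - 1 / (n : ℝ) * ∑ i : Fin n, f (z i)) - t ^ 2 * p / 2))
        = ∏ i, Real.exp (t * (p - f (z i)) - t ^ 2 * p / 2) := by
    intro z
    rw [← Real.exp_sum]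
    simp only [Finset.sum_sub_distrib, ← Finset.mul_sum, Finset.sum_const, Finset.card_univ,
      Fintype.card_fin, nsmul_eq_mul]
    congr 1
    field_simp
  simp_rw [hprod]
  rw [integral_fintype_prod_eq_pow (fun x => Real.exp (t * (p - f x) - t ^ 2 * p / 2))]
  exact pow_le_one₀ (integral_nonneg fun x => (Real.exp_pos _).le)
    (integral_exp_lower_deviation_le_one P hf hf01 ht)

/-- The **Donsker-Varadhan** inequality. -/
lemma integral_le_klDiv_add_log_integral_exp {α : Type*} [MeasurableSpace α] {Q Q' : Measure α}
    [IsProbabilityMeasure Q] [IsProbabilityMeasure Q'] (hQ : Q ≪ Q')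
    (hint : Integrable (fun w => Real.log ((Q.rnDeriv Q') w).toReal) Q) {g : α → ℝ}
    (hg : Integrable g Q) (hg' : Integrable (fun x => Real.exp (g x)) Q') :
    ∫ x, g x ∂Q ≤ klDiv Q Q' + Real.log (∫ x, Real.exp (g x) ∂Q') := by
  have := isProbabilityMeasure_tilted hg'
  have h := InformationTheory.integral_llr_add_sub_measure_univ_nonneg
    (hQ.trans (absolutelyContinuous_tilted hg')) (integrable_llr_tilted_right hQ hg hint hg')
  rw [integral_llr_tilted_right hQ hg hg' hint] at h
  simp only [probReal_univ, llr] at h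
  unfold klDiv
  linarith

/-- Markov's inequality, bounding the probability of the complementary event from below. -/
lemma ofReal_one_sub_le_measure_le_inv {α : Type*} [MeasurableSpace α] (μ : Measure α)
    [IsProbabilityMeasure μ] {X : α → ℝ} (hX : Measurable X) (hX0 : ∀ x, 0 ≤ X x)
    (hXi : Integrable X μ) (hX1 : ∫ x, X x ∂μ ≤ 1) {δ : ℝ} (hδ : 0 < δ) :
    ENNReal.ofReal (1 - δ) ≤ μ {x | X x ≤ δ⁻¹} := by
  have hM := mul_meas_ge_le_integral_of_nonneg (ae_of_all _ hX0) hXi δ⁻¹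
  have hs : MeasurableSet {x | X x ≤ δ⁻¹} := measurableSet_le hX measurable_const
  have hc : μ.real {x | X x ≤ δ⁻¹}ᶜ ≤ μ.real {x | δ⁻¹ ≤ X x} :=
    measureReal_mono fun x hx => (lt_of_not_ge (show ¬ X x ≤ δ⁻¹ from hx)).le
  rw [probReal_compl_eq_one_sub hs] at hc
  have hb : μ.real {x | δ⁻¹ ≤ X x} ≤ δ := by
    have := hM.trans hX1
    rwa [inv_mul_le_iff₀ hδ, mul_one] at this
  rw [← ofReal_measureReal]
  exact ENNReal.ofReal_le_ofReal (by linarith)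

/-- On `[0, ∞)`, the concave quadratic `t ↦ t * (p - q) - t ^ 2 * p / 2` is bounded, up to an error
`1 / (2 * m ^ 2)`, by its values on the grid of mesh `1 / m` in `[0, 1)`. -/
lemma exists_grid_quadratic_le {p q : ℝ} (hp : p ∈ Set.Icc (0 : ℝ) 1) (hq : 0 ≤ q) {m : ℕ}
    (hm : 0 < m) {t : ℝ} (ht : 0 ≤ t) :
    ∃ j ∈ Finset.range m, t * (p - q) - t ^ 2 * p / 2 ≤
      (j / m : ℝ) * (p - q) - (j / m : ℝ) ^ 2 * p / 2 + 1 / (2 * (m : ℝ) ^ 2) := by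
  obtain ⟨hp0, hp1⟩ := hp
  have hm' : (0 : ℝ) < m := by exact_mod_cast hm
  rcases le_or_gt p q with h | h
  · refine ⟨0, Finset.mem_range.2 hm, ?_⟩
    have : 0 ≤ 1 / (2 * (m : ℝ) ^ 2) := by positivity
    simp only [Nat.cast_zero, zero_div]
    nlinarith [mul_nonneg ht (sub_nonneg.2 h), mul_nonneg (sq_nonneg t) hp0]
  · have hp : 0 < p := hq.trans_lt h
    obtain ⟨s, hs⟩ : ∃ s, s = (p - q) / p := ⟨_, rfl⟩
    have hs0 : 0 < s := hs ▸ div_pos (sub_pos.2 h) hp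
    have hs1 : s ≤ 1 := by rw [hs, div_le_one hp]; linarith
    have hpq : p - q = p * s := by rw [hs]; field_simp
    have hk0 : 0 < ⌈m * s⌉₊ := Nat.ceil_pos.2 (by positivity)
    have hkm : ⌈m * s⌉₊ ≤ m := Nat.ceil_le.2 (by nlinarith)
    obtain ⟨j, hj⟩ := Nat.exists_eq_add_of_le' hk0
    have hju : (j : ℝ) < m * s := Nat.lt_ceil.1 (by omega)
    have hjl : m * s ≤ (j : ℝ) + 1 := by
      have := Nat.le_ceil (m * s)
      rw [hj] at this
      exact_mod_cast this
    refine ⟨j, Finset.mem_range.2 (by omega), ?_⟩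
    set u : ℝ := j / m with hu
    have hjm : (j : ℝ) = m * u := by rw [hu]; field_simp
    rw [hjm] at hju hjl
    have h1 : 1 / (2 * (m : ℝ) ^ 2) = (1 / m) ^ 2 / 2 := by field_simp
    have h2 : 0 ≤ s - u := by nlinarith
    have h3 : s - u ≤ 1 / m := by rw [le_div_iff₀ hm']; nlinarith
    have h4 : p * (s - u) ^ 2 ≤ (1 / m) ^ 2 :=
      (mul_le_of_le_one_left (sq_nonneg _) hp1).trans (pow_le_pow_left₀ h2 h3 2)
    rw [h1, hpq]
    nlinarith [mul_nonneg hp0 (sq_nonneg (t - s))]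

lemma exists_grid_size_mul_exp_le {n : ℕ} (hn : 1 ≤ n) :
    ∃ m : ℕ, 0 < m ∧ m * Real.exp (n * (1 / (2 * (m : ℝ) ^ 2))) ≤ 2 * Real.sqrt n := by
  obtain ⟨k, rfl⟩ := Nat.exists_eq_add_of_le' hn
  refine ⟨Nat.sqrt k + 1, Nat.succ_pos _, ?_⟩
  have hl := Nat.sqrt_le' k
  have hu := Nat.lt_succ_sqrt' k
  set s := Nat.sqrt k
  obtain ⟨m, hm⟩ : ∃ m : ℝ, m = ((s + 1 : ℕ) : ℝ) := ⟨_, rfl⟩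
  obtain ⟨r, hr⟩ : ∃ r : ℝ, r = Real.sqrt ((k + 1 : ℕ) : ℝ) := ⟨_, rfl⟩
  have hr2 : ((k + 1 : ℕ) : ℝ) = r ^ 2 := by rw [hr, Real.sq_sqrt (by positivity)]
  rw [← hm, ← hr, hr2]
  have hm1 : 1 ≤ m := by rw [hm]; push_cast; linarith [Nat.cast_nonneg (α := ℝ) s]
  have hr0 : 0 ≤ r := hr ▸ Real.sqrt_nonneg _
  have hsm : (s : ℝ) = m - 1 := by rw [hm]; push_cast; ring
  have hl' : (m - 1) ^ 2 + 1 ≤ r ^ 2 := by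
    rw [← hr2, ← hsm]; exact_mod_cast Nat.succ_le_succ hl
  have hu' : r ^ 2 ≤ m ^ 2 := by
    rw [← hr2, hm]; exact_mod_cast hu
  have hm0 : 0 < m := by linarith
  obtain ⟨x, hx⟩ : ∃ x, x = r / m := ⟨_, rfl⟩
  have hrx : r = m * x := by rw [hx]; field_simp
  have hx1 : x ≤ 1 := by rw [hx, div_le_one hm0]; exact (sq_le_sq₀ hr0 hm0.le).1 hu'
  have hx2 : 2 / 3 ≤ x := by
    rw [hx, le_div_iff₀ hm0]
    refine (sq_le_sq₀ (by positivity) hr0).1 ?_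
    nlinarith [sq_nonneg (5 * m - 9)]
  have he : r ^ 2 * (1 / (2 * m ^ 2)) = x ^ 2 / 2 := by rw [hrx]; field_simp
  have hle : Real.exp (x ^ 2 / 2) ≤ 2 * x := by
    have h1 := Real.add_one_le_exp (-(x ^ 2 / 2))
    have h2 : Real.exp (x ^ 2 / 2) * Real.exp (-(x ^ 2 / 2)) = 1 := by
      rw [← Real.exp_add]; simp
    have h3 : 1 ≤ 2 * x * Real.exp (-(x ^ 2 / 2)) := by
      have : 2 * x * (-(x ^ 2 / 2) + 1) ≤ 2 * x * Real.exp (-(x ^ 2 / 2)) := by gcongr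
      nlinarith [mul_nonneg (sub_nonneg.2 hx1) (by nlinarith : 0 ≤ x ^ 2 + x - 1)]
    rw [← h2] at h3
    exact le_of_mul_le_mul_right h3 (Real.exp_pos _)
  rw [he, hrx]
  nlinarith

/-- **PAC-Bayes-lambda bound.**  Let `P` be a probability measure on a
measurable space `𝒵`, let `ℓ : 𝒲 × 𝒵 → ℝ` be a jointly measurable loss with
values in `[0,1]`, and define the risk `L w = ∫ ℓ(w,z) dP(z)` and the empirical
risk `L̂ₙ(w, z) = (1/n)·∑ᵢ ℓ(w, zᵢ)` on a sample `z ∈ 𝒵ⁿ`.  Fix a prior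
probability measure `Q⁰` on `𝒲`, `n ≥ 1` and `δ ∈ (0,1)`.  Then with
probability at least `1 - δ` over size-`n` i.i.d. samples from `P`,
simultaneously for all posterior probability measures `Q` on `𝒲` (those with
infinite KL divergence to `Q⁰` satisfy the bound trivially, so we quantify over
the `Q` with `Q ≪ Q⁰` and integrable log-density, i.e. finite KL) and all
`λ ∈ (0,2)`:
`Q[L] ≤ Q[L̂ₙ]/(1 - λ/2) + (KL(Q‖Q⁰) + log(2√n/δ))/(n·λ·(1 - λ/2))`. -/
theorem pac_bayes_lambda_bound
    {𝒵 𝒲 : Type*} [MeasurableSpace 𝒵] [MeasurableSpace 𝒲]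
    (P : Measure 𝒵) [IsProbabilityMeasure P]
    (ℓ : 𝒲 × 𝒵 → ℝ) (hℓmeas : Measurable ℓ)
    (hℓbdd : ∀ p, ℓ p ∈ Set.Icc (0 : ℝ) 1)
    (Q0 : Measure 𝒲) [IsProbabilityMeasure Q0]
    (n : ℕ) (hn : 1 ≤ n) (δ : ℝ) (hδ : δ ∈ Set.Ioo (0 : ℝ) 1) :
    ENNReal.ofReal (1 - δ) ≤
      (Measure.pi fun _ : Fin n => P)
        {z : Fin n → 𝒵 |
          ∀ Q : Measure 𝒲, IsProbabilityMeasure Q → Q ≪ Q0 →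
            Integrable (fun w => Real.log ((Q.rnDeriv Q0) w).toReal) Q →
            ∀ lam : ℝ, 0 < lam → lam < 2 →
              ∫ w, (∫ zz, ℓ (w, zz) ∂P) ∂Q ≤
                (∫ w, (1 / (n : ℝ)) * ∑ i : Fin n, ℓ (w, z i) ∂Q) / (1 - lam / 2) +
                  (klDiv Q Q0 + Real.log (2 * Real.sqrt n / δ)) /
                    (n * lam * (1 - lam / 2))} := by
  obtain ⟨hδ0, -⟩ := hδ
  have hn0 : (0 : ℝ) < n := by exact_mod_cast hn
  obtain ⟨m, hm, hmexp⟩ := exists_grid_size_mul_exp_le hn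
  have hm' : (0 : ℝ) < m := by exact_mod_cast hm
  set L : 𝒲 → ℝ := fun w => ∫ zz, ℓ (w, zz) ∂P with hLdef
  set E : 𝒲 → (Fin n → 𝒵) → ℝ := fun w z => (1 / (n : ℝ)) * ∑ i : Fin n, ℓ (w, z i) with hEdef
  have hLm : Measurable L := hℓmeas.stronglyMeasurable.integral_prod_right'.measurable
  have hEm : Measurable fun y : (Fin n → 𝒵) × 𝒲 => E y.2 y.1 := by
    simp only [hEdef]; fun_prop
  have hLmem : ∀ w, L w ∈ Set.Icc (0 : ℝ) 1 := fun w => by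
    refine ⟨integral_nonneg fun zz => (hℓbdd _).1, ?_⟩
    have := integral_mono_of_nonneg (μ := P) (ae_of_all _ fun zz => (hℓbdd (w, zz)).1)
      (integrable_const (1 : ℝ)) (ae_of_all _ fun zz => (hℓbdd (w, zz)).2)
    simpa using this
  have hEmem : ∀ w z, E w z ∈ Set.Icc (0 : ℝ) 1 := fun w z => by
    have h0 : 0 ≤ ∑ i : Fin n, ℓ (w, z i) := Finset.sum_nonneg fun i _ => (hℓbdd _).1
    have h1 : ∑ i : Fin n, ℓ (w, z i) ≤ n := by
      simpa using Finset.sum_le_sum fun (i : Fin n) (_ : i ∈ Finset.univ) => (hℓbdd (w, z i)).2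
    refine ⟨mul_nonneg (by positivity) h0, ?_⟩
    simp only [hEdef]
    rw [one_div, inv_mul_le_iff₀ hn0]
    linarith
  -- the deviation functional at a given parameter, and its exponential average over the grid
  set h : ℝ → (Fin n → 𝒵) × 𝒲 → ℝ := fun t y =>
    t * (L y.2 - E y.2 y.1) - t ^ 2 * L y.2 / 2 with hhdef
  have hhm : ∀ t, Measurable (h t) := fun t => by simp only [hhdef]; fun_prop
  have hhb : ∀ j ∈ Finset.range m, ∀ y, h (j / m) y ∈ Set.Icc (-2 : ℝ) 2 := fun j hj y => by
    obtain ⟨a0, a1⟩ := hLmem y.2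
    obtain ⟨b0, b1⟩ := hEmem y.2 y.1
    have t0 : (0 : ℝ) ≤ j / m := by positivity
    have t1 : (j / m : ℝ) ≤ 1 := by
      rw [div_le_one hm']; exact_mod_cast (Finset.mem_range.1 hj).le
    have t2 : (j / m : ℝ) ^ 2 ≤ 1 := pow_le_one₀ t0 t1
    simp only [hhdef]
    generalize (j / m : ℝ) = t at *
    have c1 := mul_nonneg t0 a0
    have c2 := mul_nonneg t0 b0
    have c3 := mul_le_one₀ t1 a0 a1
    have c4 := mul_le_one₀ t1 b0 b1
    have c5 := mul_nonneg (sq_nonneg t) a0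
    have c6 := mul_le_one₀ t2 a0 a1
    constructor <;> linarith
  set F : (Fin n → 𝒵) × 𝒲 → ℝ := fun y =>
    (∑ j ∈ Finset.range m, Real.exp (n * h (j / m) y)) / m with hFdef
  have hFm : Measurable F :=
    (Finset.measurable_sum _ fun j _ => ((hhm _).const_mul _).exp).div_const _
  have hFb : ∀ y, F y ∈ Set.Icc (Real.exp (n * -2)) (Real.exp (n * 2)) := fun y => by
    have hl := Finset.card_nsmul_le_sum (Finset.range m) (fun j => Real.exp (n * h (j / m) y))
      (Real.exp (n * -2)) fun j hj => by have := (hhb j hj y).1; gcongr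
    have hu := Finset.sum_le_card_nsmul (Finset.range m) (fun j => Real.exp (n * h (j / m) y))
      (Real.exp (n * 2)) fun j hj => by have := (hhb j hj y).2; gcongr
    simp only [Finset.card_range, nsmul_eq_mul] at hl hu
    exact ⟨by rw [le_div_iff₀ hm']; linarith, by rw [div_le_iff₀ hm']; linarith⟩
  have hFpos : ∀ y, 0 < F y := fun y => (Real.exp_pos _).trans_le (hFb y).1
  set μ : Measure (Fin n → 𝒵) := Measure.pi fun _ : Fin n => P
  have hFprod : Integrable F (μ.prod Q0) :=
    Integrable.of_mem_Icc _ _ hFm.aemeasurable (ae_of_all _ hFb)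
  have hmean : ∫ z, ∫ w, F (z, w) ∂Q0 ∂μ ≤ 1 := by
    rw [integral_integral_swap (f := fun z w => F (z, w)) hFprod]
    have hw : ∀ w, ∫ z, F (z, w) ∂μ ≤ 1 := fun w => by
      simp only [hFdef]
      rw [integral_div, div_le_one hm', integral_finsetSum]
      · refine (Finset.sum_le_card_nsmul _ _ 1 fun j _ => ?_).trans (by simp)
        exact integral_exp_empirical_lower_deviation_le_one P (f := fun zz => ℓ (w, zz))
          (hℓmeas.comp measurable_prodMk_left) (fun zz => hℓbdd _) hn (by positivity)
      · intro j hj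
        refine Integrable.of_mem_Icc (Real.exp (n * -2)) (Real.exp (n * 2)) ?_
          (ae_of_all _ fun z => ?_)
        · exact (((hhm _).comp measurable_prodMk_right).const_mul _).exp.aemeasurable
        · obtain ⟨h1, h2⟩ := hhb j hj (z, w)
          constructor <;> gcongr
    have := integral_mono_of_nonneg (μ := Q0)
      (ae_of_all _ fun w => integral_nonneg fun z => (hFpos (z, w)).le)
      (integrable_const (1 : ℝ)) (ae_of_all _ hw)
    simpa using this
  refine (ofReal_one_sub_le_measure_le_inv μ
    hFm.stronglyMeasurable.integral_prod_right'.measurable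
    (fun z => integral_nonneg fun w => (hFpos (z, w)).le) hFprod.integral_prod_left hmean
    hδ0).trans (measure_mono ?_)
  intro z hz Q hQp hQ hint lam hl0 hl2
  have hz : ∫ w, F (z, w) ∂Q0 ≤ δ⁻¹ := hz
  have hFz : Measurable fun w => F (z, w) := hFm.comp measurable_prodMk_left
  have hexplog : ∀ w, Real.exp (Real.log (F (z, w))) = F (z, w) := fun w =>
    Real.exp_log (hFpos _)
  have hlogi : Integrable (fun w => Real.log (F (z, w))) Q :=
    Integrable.of_mem_Icc (n * -2) (n * 2) hFz.log.aemeasurable (ae_of_all _ fun w =>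
      ⟨(Real.le_log_iff_exp_le (hFpos _)).2 (hFb _).1,
        (Real.log_le_iff_le_exp (hFpos _)).2 (hFb _).2⟩)
  have hFi : Integrable (fun w => F (z, w)) Q0 :=
    Integrable.of_mem_Icc _ _ hFz.aemeasurable (ae_of_all _ fun w => hFb (z, w))
  have hDV := integral_le_klDiv_add_log_integral_exp hQ hint hlogi
    (by simpa only [hexplog] using hFi)
  simp only [hexplog] at hDV
  have hFint : 0 < ∫ w, F (z, w) ∂Q0 := by
    have := integral_mono (integrable_const (Real.exp (n * -2))) hFi fun w => (hFb (z, w)).1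
    simp only [integral_const, probReal_univ, one_smul] at this
    exact (Real.exp_pos _).trans_le this
  have hlog := Real.log_le_log hFint hz
  have hsq : 0 < 2 * Real.sqrt n := by positivity
  have hpt : ∀ w, n * h lam (z, w) ≤ Real.log (F (z, w)) + Real.log (2 * Real.sqrt n) := by
    intro w
    obtain ⟨j, hj, hjle⟩ := exists_grid_quadratic_le (hLmem w) (hEmem w z).1 hm hl0.le
    rw [← Real.log_mul (hFpos _).ne' hsq.ne', Real.le_log_iff_exp_le (mul_pos (hFpos _) hsq)]
    have hsum : Real.exp (n * h (j / m) (z, w)) ≤ F (z, w) * m := by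
      simp only [hFdef]
      rw [div_mul_cancel₀ _ hm'.ne']
      exact Finset.single_le_sum (f := fun j : ℕ => Real.exp (n * h (j / m) (z, w)))
        (fun i _ => (Real.exp_pos _).le) hj
    calc Real.exp (n * h lam (z, w))
        ≤ Real.exp (n * (h (j / m) (z, w) + 1 / (2 * (m : ℝ) ^ 2))) := by
          gcongr
      _ = Real.exp (n * h (j / m) (z, w)) * Real.exp (n * (1 / (2 * (m : ℝ) ^ 2))) := by
          rw [← Real.exp_add]; ring_nf
      _ ≤ F (z, w) * m * Real.exp (n * (1 / (2 * (m : ℝ) ^ 2))) := by gcongr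
      _ ≤ F (z, w) * (2 * Real.sqrt n) := by
          rw [mul_assoc]
          exact mul_le_mul_of_nonneg_left hmexp (hFpos _).le
  have hLi : Integrable L Q := Integrable.of_mem_Icc 0 1 hLm.aemeasurable (ae_of_all _ hLmem)
  have hEi : Integrable (fun w => E w z) Q :=
    Integrable.of_mem_Icc 0 1 (hEm.comp measurable_prodMk_left).aemeasurable
      (ae_of_all _ fun w => hEmem w z)
  have hheq : ∀ w, n * h lam (z, w)
      = n * lam * (1 - lam / 2) * L w - n * lam * E w z := fun w => by
    simp only [hhdef]; ring
  simp only [hheq] at hpt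
  have hI := integral_mono ((hLi.const_mul (n * lam * (1 - lam / 2))).sub
    (hEi.const_mul (n * lam))) (hlogi.add (integrable_const (Real.log (2 * Real.sqrt n)))) hpt
  simp only [Pi.sub_apply, Pi.add_apply] at hI
  rw [integral_sub (hLi.const_mul _) (hEi.const_mul _), integral_const_mul, integral_const_mul,
    integral_add hlogi (integrable_const _), integral_const, probReal_univ, one_smul] at hI
  rw [Real.log_inv] at hlog
  rw [Real.log_div hsq.ne' hδ0.ne']
  have hlam : 0 < 1 - lam / 2 := by linarith
  have hc : 0 < n * lam * (1 - lam / 2) := by positivity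
  rw [show (∫ w, E w z ∂Q) / (1 - lam / 2)
      = n * lam * (∫ w, E w z ∂Q) / (n * lam * (1 - lam / 2)) by field_simp, ← add_div,
    le_div_iff₀ hc]
  linarith
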